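/- arXiv:1612.08865 — 2 statements merged into one kernel-verified Lean document; each statement's English description precedes it below -/
import Mathlib

section
/- There exists a unique real number p_0 satisfying Δ(p_0, σ_{p_0}) = Δ(p_0, 1) together with 2.57 ≤ p_0 ≤ 2.58. -/
/-- `σ_p = (2^p - 1)^{1/p}`. -/
noncomputable def sigmaP (p : ℝ) : ℝ := (2 ^ p - 1) ^ (1 / p)

/-- `A = A(p,σ,τ) = (1 + τ^p)^{-1/p} - (1 + σ^p)^{-1/p}`. -/
noncomputable def Acoef (p σ τ : ℝ) : ℝ := (1 + τ ^ p) ^ (-1 / p) - (1 + σ ^ p) ^ (-1 / p)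

/-- `B = B(p,σ,τ) = σ (1 + σ^p)^{-1/p} + τ (1 + τ^p)^{-1/p}`. -/
noncomputable def Bcoef (p σ τ : ℝ) : ℝ :=
  σ * (1 + σ ^ p) ^ (-1 / p) + τ * (1 + τ ^ p) ^ (-1 / p)

/-- Given the branch `T : σ ↦ τ(p,σ)`, the Minkowski–Cohn function
`Δ(p,σ) = (τ(p,σ) + σ)(1 + τ(p,σ)^p)^{-1/p}(1 + σ^p)^{-1/p}`. -/
noncomputable def DeltaFun (p : ℝ) (T : ℝ → ℝ) (σ : ℝ) : ℝ :=
  (T σ + σ) * (1 + T σ ^ p) ^ (-1 / p) * (1 + σ ^ p) ^ (-1 / p)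

set_option exponentiation.threshold 1000

/-- Strict convexity of `x ↦ x ^ p`: increments over steps of equal length increase. -/
theorem rpow_increment_lt {p a b h : ℝ} (hp : 1 < p) (ha : 0 ≤ a) (hab : a < b) (hh : 0 < h) :
    b ^ p + (a + h) ^ p < (b + h) ^ p + a ^ p := by
  have hc := (strictConvexOn_rpow hp).2 (x := a) (y := b + h) ha
    (show (0 : ℝ) ≤ b + h by linarith) (by linarith)
  have hd : 0 < b - a + h := by linarith
  have hb := hc (a := h / (b - a + h)) (b := (b - a) / (b - a + h)) (by positivity)
    (div_pos (by linarith) hd) (by field_simp; ring)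
  have hah := hc (a := (b - a) / (b - a + h)) (b := h / (b - a + h))
    (div_pos (by linarith) hd) (by positivity) (by field_simp)
  simp only [smul_eq_mul] at hb hah
  rw [show h / (b - a + h) * a + (b - a) / (b - a + h) * (b + h) = b by field_simp; ring] at hb
  rw [show (b - a) / (b - a + h) * a + h / (b - a + h) * (b + h) = a + h by
    field_simp; ring] at hah
  have hsum : (b - a) / (b - a + h) = 1 - h / (b - a + h) := by field_simp; ring
  rw [hsum] at hb hah
  nlinarith

/-- The `p`-th power of the radial factor `(1 + t ^ p) ^ (-1 / p)`. -/
theorem radial_rpow {p t : ℝ} (hp : 1 < p) (ht : 0 ≤ t) :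
    ((1 + t ^ p) ^ (-1 / p)) ^ p = (1 + t ^ p)⁻¹ := by
  have : 0 ≤ t ^ p := Real.rpow_nonneg ht p
  rw [← Real.rpow_mul (by linarith), div_mul_cancel₀ _ (by linarith), Real.rpow_neg_one]

theorem coef_sum_lt {p σ t₁ t₂ : ℝ} (hp : 1 < p) (ht₁ : 0 ≤ t₁) (ht : t₁ < t₂) (ht₂ : t₂ ≤ 1)
    (hσ : 1 ≤ σ) :
    Acoef p σ t₁ ^ p + Bcoef p σ t₁ ^ p < Acoef p σ t₂ ^ p + Bcoef p σ t₂ ^ p := by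
  have hp0 : 0 < p := by linarith
  have ht₂0 : 0 < t₂ := by linarith
  have hneg : -1 / p < 0 := div_neg_of_neg_of_pos (by norm_num) hp0
  have h1 : 0 ≤ t₁ ^ p := Real.rpow_nonneg ht₁ p
  have h12 : t₁ ^ p < t₂ ^ p := Real.rpow_lt_rpow ht₁ ht hp0
  have h2σ : t₂ ^ p ≤ σ ^ p := Real.rpow_le_rpow ht₂0.le (by linarith) hp0.le
  have hu : (1 + t₂ ^ p) ^ (-1 / p) < (1 + t₁ ^ p) ^ (-1 / p) :=
    Real.rpow_lt_rpow_of_neg (by linarith) (by linarith) hneg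
  have hc : (1 + σ ^ p) ^ (-1 / p) ≤ (1 + t₂ ^ p) ^ (-1 / p) :=
    Real.rpow_le_rpow_of_nonpos (by linarith) (by linarith) hneg.le
  have hc0 : 0 < (1 + σ ^ p) ^ (-1 / p) := Real.rpow_pos_of_pos (by linarith) _
  have e1 := radial_rpow hp ht₁
  have e2 := radial_rpow hp ht₂0.le
  unfold Acoef Bcoef
  set u₁ := (1 + t₁ ^ p) ^ (-1 / p)
  set u₂ := (1 + t₂ ^ p) ^ (-1 / p)
  set c := (1 + σ ^ p) ^ (-1 / p)
  have hu₂ : 0 < u₂ := by linarith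
  have hu₁ : 0 < u₁ := by linarith
  have f1 : u₁ ^ p + (t₁ * u₁) ^ p = 1 := by
    rw [Real.mul_rpow ht₁ hu₁.le, e1]; field_simp
  have f2 : u₂ ^ p + (t₂ * u₂) ^ p = 1 := by
    rw [Real.mul_rpow ht₂0.le hu₂.le, e2]; field_simp
  have hup : u₂ ^ p < u₁ ^ p := Real.rpow_lt_rpow hu₂.le hu hp0
  have hy : t₁ * u₁ < t₂ * u₂ := by
    refine (Real.rpow_lt_rpow_iff (by positivity) (by positivity) hp0).1 ?_
    linarith
  have g1 := rpow_increment_lt hp (a := t₁ * u₁) (b := t₂ * u₂) (h := σ * c) (by positivity) hy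
    (by positivity)
  have g2 := rpow_increment_lt hp (a := u₂ - c) (b := u₁ - c) (h := c) (by linarith)
    (by linarith) hc0
  simp only [sub_add_cancel] at g2
  rw [add_comm (σ * c), add_comm (σ * c)]
  linarith

theorem coef_sum_inj {p σ s t : ℝ} (hp : 1 < p) (hσ : 1 ≤ σ) (hs : 0 ≤ s) (hs1 : s ≤ 1)
    (ht : 0 ≤ t) (ht1 : t ≤ 1)
    (h : Acoef p σ s ^ p + Bcoef p σ s ^ p = Acoef p σ t ^ p + Bcoef p σ t ^ p) : s = t := by
  rcases lt_trichotomy s t with hst | hst | hst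
  · exact absurd h (coef_sum_lt hp hs hst ht1 hσ).ne
  · exact hst
  · exact absurd h (coef_sum_lt hp ht hst hs1 hσ).ne'

theorem sigmaP_rpow {p : ℝ} (hp : 1 < p) : sigmaP p ^ p = 2 ^ p - 1 := by
  have : (1 : ℝ) ≤ 2 ^ p := Real.one_le_rpow (by norm_num) (by linarith)
  rw [sigmaP, ← Real.rpow_mul (by linarith), div_mul_cancel₀ _ (by linarith), Real.rpow_one]

theorem one_le_sigmaP {p : ℝ} (hp : 1 < p) : 1 ≤ sigmaP p := by
  have : (2 : ℝ) ^ (1 : ℝ) ≤ 2 ^ p := Real.rpow_le_rpow_of_exponent_le (by norm_num) hp.le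
  rw [Real.rpow_one] at this
  exact Real.one_le_rpow (by linarith) (by positivity)

theorem radial_sigmaP {p : ℝ} (hp : 1 < p) : (1 + sigmaP p ^ p) ^ (-1 / p) = 1 / 2 := by
  rw [sigmaP_rpow hp, add_sub_cancel, ← Real.rpow_mul (by norm_num),
    mul_div_cancel₀ _ (by linarith), Real.rpow_neg_one, one_div]

theorem coef_sum_sigmaP_zero {p : ℝ} (hp : 1 < p) :
    Acoef p (sigmaP p) 0 ^ p + Bcoef p (sigmaP p) 0 ^ p = 1 := by
  have h0 : (0 : ℝ) ^ p = 0 := Real.zero_rpow (by linarith)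
  have hσ := one_le_sigmaP hp
  have h2 : (0 : ℝ) < 2 ^ p := by positivity
  rw [Acoef, Bcoef, radial_sigmaP hp, h0, zero_mul, add_zero, add_zero, Real.one_rpow,
    Real.mul_rpow (by linarith) (by norm_num), sigmaP_rpow hp,
    show (1 : ℝ) - 1 / 2 = 1 / 2 by norm_num, Real.div_rpow (by norm_num) (by norm_num),
    Real.one_rpow]
  field_simp
  ring

theorem radial_of_eq {p t : ℝ} (hp : 1 < p) (ht1 : t < 1)
    (h : 2 * (1 - t) ^ p = 1 + t ^ p) :
    (1 + t ^ p) ^ (-1 / p) = 2 ^ (-1 / p) / (1 - t) := by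
  have ht : 0 ≤ 1 - t := by linarith
  rw [← h, Real.mul_rpow (by norm_num) (Real.rpow_nonneg ht p), ← Real.rpow_mul ht,
    mul_div_cancel₀ _ (by linarith), Real.rpow_neg_one, ← div_eq_mul_inv]

theorem two_radial_rpow {p : ℝ} (hp : 1 < p) : ((2 : ℝ) ^ (-1 / p)) ^ p = 1 / 2 := by
  rw [← Real.rpow_mul (by norm_num), div_mul_cancel₀ _ (by linarith), Real.rpow_neg_one, one_div]

theorem coef_sum_one {p t : ℝ} (hp : 1 < p) (ht : 0 ≤ t) (ht1 : t < 1)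
    (h : 2 * (1 - t) ^ p = 1 + t ^ p) : Acoef p 1 t ^ p + Bcoef p 1 t ^ p = 1 := by
  have h1 : 0 < 1 - t := by linarith
  have hc := two_radial_rpow hp
  rw [Acoef, Bcoef, radial_of_eq hp ht1 h, Real.one_rpow, one_add_one_eq_two]
  set c := (2 : ℝ) ^ (-1 / p)
  have hc0 : 0 < c := by positivity
  have hpow : 0 < (1 - t) ^ p := Real.rpow_pos_of_pos h1 p
  rw [show c / (1 - t) - c = c * t / (1 - t) by field_simp; ring,
    show 1 * c + t * (c / (1 - t)) = c / (1 - t) by field_simp; ring,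
    Real.div_rpow (by positivity) h1.le, Real.div_rpow hc0.le h1.le,
    Real.mul_rpow hc0.le ht, hc]
  field_simp
  linarith

/-- The value of `(1 + τ_p) / (1 - τ_p)` at which the two endpoint values of the
Minkowski–Cohn function coincide. -/
noncomputable def critRatio (p : ℝ) : ℝ := (4 - 4 * 2 ^ (-p)) ^ (1 / p)

/-- The defect of `critRatio p` in the equation characterizing `(1 + τ_p) / (1 - τ_p)`. -/
noncomputable def critDefect (p : ℝ) : ℝ :=
  ((critRatio p + 1) / 2) ^ p + ((critRatio p - 1) / 2) ^ p - 2

theorem critRatio_mul {p : ℝ} (hp : 1 < p) :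
    critRatio p * (2 ^ (-1 / p) * 2 ^ (-1 / p)) = sigmaP p / 2 := by
  have h2 : (0 : ℝ) < 2 ^ p := by positivity
  have h1 : (1 : ℝ) ≤ 2 ^ p := Real.one_le_rpow (by norm_num) (by linarith)
  have hhalf : ((2 : ℝ) ^ p) ^ (1 / p) = 2 := by
    rw [← Real.rpow_mul (by norm_num), mul_one_div_cancel (by linarith), Real.rpow_one]
  have hfour : (4 : ℝ) ^ (1 / p) = 2 ^ (1 / p) * 2 ^ (1 / p) := by
    rw [← Real.mul_rpow (by norm_num) (by norm_num)]; norm_num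
  rw [critRatio, sigmaP, Real.rpow_neg (by norm_num),
    show 4 - 4 * ((2 : ℝ) ^ p)⁻¹ = 4 * ((2 ^ p - 1) / 2 ^ p) by field_simp,
    Real.mul_rpow (by norm_num) (div_nonneg (by linarith) h2.le),
    Real.div_rpow (by linarith) h2.le, hhalf, hfour, neg_div, Real.rpow_neg (by norm_num)]
  field_simp

theorem defect_strictMonoOn {p : ℝ} (hp : 1 < p) :
    StrictMonoOn (fun x : ℝ => ((x + 1) / 2) ^ p + ((x - 1) / 2) ^ p) (Set.Ici 1) := by
  intro x hx y hy hxy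
  simp only [Set.mem_Ici] at hx hy
  exact add_lt_add (Real.rpow_lt_rpow (by linarith) (by linarith) (by linarith))
    (Real.rpow_lt_rpow (by linarith) (by linarith) (by linarith))

theorem defect_of_eq {p t : ℝ} (ht : 0 ≤ t) (ht1 : t < 1)
    (h : 2 * (1 - t) ^ p = 1 + t ^ p) :
    (((1 + t) / (1 - t) + 1) / 2) ^ p + (((1 + t) / (1 - t) - 1) / 2) ^ p = 2 := by
  have h1 : 0 < 1 - t := by linarith
  have hpow : 0 < (1 - t) ^ p := Real.rpow_pos_of_pos h1 p
  rw [show ((1 + t) / (1 - t) + 1) / 2 = 1 / (1 - t) by field_simp; ring,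
    show ((1 + t) / (1 - t) - 1) / 2 = t / (1 - t) by field_simp; ring,
    Real.div_rpow (by norm_num) h1.le, Real.div_rpow ht h1.le, Real.one_rpow]
  field_simp
  linarith

theorem critRatio_eq_iff {p t : ℝ} (hp : 1 < p) (hr : 1 ≤ critRatio p) (ht : 0 ≤ t) (ht1 : t < 1)
    (h : 2 * (1 - t) ^ p = 1 + t ^ p) :
    critRatio p = (1 + t) / (1 - t) ↔ critDefect p = 0 := by
  have hr' : 1 ≤ (1 + t) / (1 - t) := by
    rw [le_div_iff₀ (by linarith)]; linarith
  rw [← (defect_strictMonoOn hp).injOn.eq_iff hr hr', critDefect, sub_eq_zero]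
  simp only [defect_of_eq ht ht1 h]

theorem deltaFun_eq_iff {p : ℝ} {T : ℝ → ℝ} {t : ℝ} (hp : 1 < p) (hr : 1 ≤ critRatio p)
    (ht : 0 ≤ t) (ht1 : t < 1) (h : 2 * (1 - t) ^ p = 1 + t ^ p)
    (hT : ∀ σ ∈ Set.Icc 1 (sigmaP p),
      0 ≤ T σ ∧ T σ ≤ t ∧ Acoef p σ (T σ) ^ p + Bcoef p σ (T σ) ^ p = 1) :
    DeltaFun p T (sigmaP p) = DeltaFun p T 1 ↔ critDefect p = 0 := by
  have hσ := one_le_sigmaP hp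
  obtain ⟨a0, a1, a2⟩ := hT 1 ⟨le_rfl, hσ⟩
  obtain ⟨b0, b1, b2⟩ := hT (sigmaP p) ⟨hσ, le_rfl⟩
  have hT1 : T 1 = t := coef_sum_inj hp le_rfl a0 (by linarith) ht ht1.le
    (a2.trans (coef_sum_one hp ht ht1 h).symm)
  have hTσ : T (sigmaP p) = 0 := coef_sum_inj hp hσ b0 (by linarith) le_rfl zero_le_one
    (b2.trans (coef_sum_sigmaP_zero hp).symm)
  have h1 : 1 - t ≠ 0 := by linarith
  have hm := critRatio_mul hp
  rw [← critRatio_eq_iff hp hr ht ht1 h, DeltaFun, DeltaFun, hT1, hTσ, radial_sigmaP hp,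
    radial_of_eq hp ht1 h, Real.zero_rpow (by linarith), Real.one_rpow, add_zero, Real.one_rpow,
    one_add_one_eq_two]
  set c := (2 : ℝ) ^ (-1 / p)
  have hc : 0 < c := by positivity
  rw [show (0 + sigmaP p) * 1 * (1 / 2) = sigmaP p / 2 by ring, ← hm,
    show (t + 1) * (c / (1 - t)) * c = (1 + t) / (1 - t) * (c * c) by field_simp; ring]
  exact mul_left_inj' (by positivity)

theorem rpow_le_of_pow_le {x y p : ℝ} (m n : ℕ) (hx : 0 ≤ x) (hy : 0 ≤ y) (hn : n ≠ 0)
    (hp : p * n = m) (h : x ^ m ≤ y ^ n) : x ^ p ≤ y := by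
  refine le_of_pow_le_pow_left₀ hn hy ?_
  rwa [← Real.rpow_mul_natCast hx, hp, Real.rpow_natCast]

theorem le_rpow_of_pow_le {x y p : ℝ} (m n : ℕ) (hx : 0 ≤ x) (hn : n ≠ 0)
    (hp : p * n = m) (h : y ^ n ≤ x ^ m) : y ≤ x ^ p := by
  refine le_of_pow_le_pow_left₀ hn (Real.rpow_nonneg hx p) ?_
  rwa [← Real.rpow_mul_natCast hx, hp, Real.rpow_natCast]

theorem mul_log_le_of_pow_le {x y q : ℝ} (m n : ℕ) (hx : 0 < x) (hn : 0 < n)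
    (hq : q * n = m) (h : x ^ m ≤ y ^ n) : q * Real.log x ≤ Real.log y := by
  have hl := Real.log_le_log (by positivity) h
  rw [Real.log_pow, Real.log_pow, ← hq] at hl
  have hn' : (0 : ℝ) < n := by exact_mod_cast hn
  nlinarith

theorem log_le_mul_of_pow_le {x y q : ℝ} (m n : ℕ) (hy : 0 < y) (hn : 0 < n)
    (hq : q * n = m) (h : y ^ n ≤ x ^ m) : Real.log y ≤ q * Real.log x := by
  have hl := Real.log_le_log (by positivity) h
  rw [Real.log_pow, Real.log_pow, ← hq] at hl
  have hn' : (0 : ℝ) < n := by exact_mod_cast hn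
  nlinarith

theorem two_rpow_neg_mem {p : ℝ} (h1 : 2.57 ≤ p) (h2 : p ≤ 2.58) :
    (2 : ℝ) ^ (-p) ∈ Set.Icc 0.16724 0.168405 := by
  rw [Real.rpow_neg (by norm_num), ← Real.inv_rpow (by norm_num)]
  constructor
  · refine le_trans ?_
      (Real.rpow_le_rpow_of_exponent_ge (by norm_num) (by norm_num) h2)
    exact le_rpow_of_pow_le 258 100 (by norm_num) (by norm_num) (by norm_num) (by norm_num)
  · refine le_trans (Real.rpow_le_rpow_of_exponent_ge (by norm_num) (by norm_num) h1) ?_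
    exact rpow_le_of_pow_le 257 100 (by norm_num) (by norm_num) (by norm_num) (by norm_num)
      (by norm_num)

theorem critRatio_mem {p : ℝ} (h1 : 2.57 ≤ p) (h2 : p ≤ 2.58) :
    critRatio p ∈ Set.Icc 1.5933 1.5972 := by
  obtain ⟨hq1, hq2⟩ := two_rpow_neg_mem h1 h2
  have hp : 0 < p := by linarith
  unfold critRatio
  constructor
  · rw [one_div, Real.le_rpow_inv_iff_of_pos (by norm_num) (by linarith) hp]
    refine (Real.rpow_le_rpow_of_exponent_le (by norm_num) h2).trans ?_
    refine (rpow_le_of_pow_le (y := 3.32638) 258 100 (by norm_num) (by norm_num) (by norm_num)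
      (by norm_num) (by norm_num)).trans (by linarith)
  · rw [one_div, Real.rpow_inv_le_iff_of_pos (by linarith) (by norm_num) hp]
    refine le_trans ?_ (Real.rpow_le_rpow_of_exponent_le (by norm_num) h1)
    refine le_trans (by linarith) (le_rpow_of_pow_le (y := 3.33104) 257 100 (by norm_num)
      (by norm_num) (by norm_num) (by norm_num))

theorem hasDerivAt_critRatio {p : ℝ} (hp : 1 < p) (hr : 0 < critRatio p) :
    HasDerivAt critRatio (critRatio p / p *
      (Real.log 2 * (2 ^ (-p) / (1 - 2 ^ (-p))) - Real.log (critRatio p))) p := by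
  have hq : (2 : ℝ) ^ (-p) < 1 := Real.rpow_lt_one_of_one_lt_of_neg (by norm_num) (by linarith)
  have hw : 0 < 4 - 4 * (2 : ℝ) ^ (-p) := by linarith
  have hd : HasDerivAt (fun x : ℝ => 4 - 4 * (2 : ℝ) ^ (-x)) (4 * (Real.log 2 * 2 ^ (-p))) p := by
    have := (((hasDerivAt_id p).neg.const_rpow (a := 2) (by norm_num)).const_mul 4).const_sub 4
    refine this.congr_deriv ?_
    simp
  have hi : HasDerivAt (fun x : ℝ => 1 / x) (-(p ^ 2)⁻¹) p := by
    simpa [one_div] using hasDerivAt_inv (show p ≠ 0 by linarith)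
  have hpow := hd.rpow hi hw
  have hlog : Real.log (critRatio p) = 1 / p * Real.log (4 - 4 * 2 ^ (-p)) := by
    rw [critRatio, Real.log_rpow hw]
  refine hpow.congr_deriv ?_
  rw [Real.rpow_sub_one hw.ne', hlog]
  change _ * (critRatio p / _) + _ * critRatio p * _ = _
  have h1 : 1 - (2 : ℝ) ^ (-p) ≠ 0 := by linarith
  rw [show 4 - 4 * (2 : ℝ) ^ (-p) = 4 * (1 - 2 ^ (-p)) by ring]
  generalize Real.log (4 * (1 - (2 : ℝ) ^ (-p))) = l
  generalize (2 : ℝ) ^ (-p) = q at *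
  field_simp
  ring

theorem hasDerivAt_critDefect {p : ℝ} (hp : 1 < p) (hr : 1 < critRatio p) :
    HasDerivAt critDefect
      (((critRatio p + 1) / 2) ^ p * Real.log ((critRatio p + 1) / 2) +
        ((critRatio p - 1) / 2) ^ p * Real.log ((critRatio p - 1) / 2) -
        critRatio p / 2 *
          (Real.log (critRatio p) - Real.log 2 * (2 ^ (-p) / (1 - 2 ^ (-p)))) *
          (((critRatio p + 1) / 2) ^ (p - 1) + ((critRatio p - 1) / 2) ^ (p - 1))) p := by
  have hd := hasDerivAt_critRatio hp (by linarith)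
  have ha := ((hd.add_const 1).div_const 2).rpow (hasDerivAt_id p) (by linarith)
  have hb := ((hd.sub_const 1).div_const 2).rpow (hasDerivAt_id p) (by linarith)
  refine ((ha.add hb).sub_const 2).congr_deriv ?_
  simp only [id]
  field_simp
  ring

theorem critDefect_deriv_pos {p : ℝ} (h1 : 2.57 ≤ p) (h2 : p ≤ 2.58) :
    0 < ((critRatio p + 1) / 2) ^ p * Real.log ((critRatio p + 1) / 2) +
        ((critRatio p - 1) / 2) ^ p * Real.log ((critRatio p - 1) / 2) -
        critRatio p / 2 *
          (Real.log (critRatio p) - Real.log 2 * (2 ^ (-p) / (1 - 2 ^ (-p)))) *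
          (((critRatio p + 1) / 2) ^ (p - 1) + ((critRatio p - 1) / 2) ^ (p - 1)) := by
  obtain ⟨hq1, hq2⟩ := two_rpow_neg_mem h1 h2
  obtain ⟨hr1, hr2⟩ := critRatio_mem h1 h2
  set q := (2 : ℝ) ^ (-p)
  set r := critRatio p
  have hL : 0 < Real.log 2 := Real.log_pos (by norm_num)
  have hloga : 0.374 * Real.log 2 ≤ Real.log ((r + 1) / 2) :=
    (mul_log_le_of_pow_le (y := 1.29665) 187 500 (by norm_num) (by norm_num) (by norm_num)
      (by norm_num)).trans (Real.log_le_log (by norm_num) (by linarith))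
  have hlogb : -(1.754 * Real.log 2) ≤ Real.log ((r - 1) / 2) := by
    rw [neg_le, ← Real.log_inv]
    refine (Real.log_le_log (inv_pos.2 (by linarith))
      (inv_anti₀ (b := 0.29665) (by norm_num) (by linarith))).trans ?_
    exact log_le_mul_of_pow_le 877 500 (by norm_num) (by norm_num) (by norm_num) (by norm_num)
  have hlogr : Real.log r ≤ 0.676 * Real.log 2 :=
    (Real.log_le_log (by linarith) hr2).trans
      (log_le_mul_of_pow_le 169 250 (by norm_num) (by norm_num) (by norm_num) (by norm_num))
  have hqq : 0.2008 ≤ q / (1 - q) := by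
    rw [le_div_iff₀ (by linarith)]; linarith
  have hap : 1.949 ≤ ((r + 1) / 2) ^ p := by
    refine le_trans ?_ ((Real.rpow_le_rpow (z := 2.57) (by norm_num) (show 1.29665 ≤ (r + 1) / 2 by
      linarith) (by norm_num)).trans (Real.rpow_le_rpow_of_exponent_le (by linarith) h1))
    exact le_rpow_of_pow_le 257 100 (by norm_num) (by norm_num) (by norm_num) (by norm_num)
  have hbp : ((r - 1) / 2) ^ p ≤ 0.0448 := by
    refine ((Real.rpow_le_rpow_of_exponent_ge (by linarith) (by linarith) h1).trans
      (Real.rpow_le_rpow (by linarith) (show (r - 1) / 2 ≤ 0.2986 by linarith)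
        (by norm_num))).trans ?_
    exact rpow_le_of_pow_le 257 100 (by norm_num) (by norm_num) (by norm_num) (by norm_num)
      (by norm_num)
  have hap' : ((r + 1) / 2) ^ (p - 1) ≤ 1.5112 := by
    refine ((Real.rpow_le_rpow_of_exponent_le (y := p - 1) (z := 1.58) (by linarith)
      (by linarith)).trans
      (Real.rpow_le_rpow (by linarith) (show (r + 1) / 2 ≤ 1.2986 by linarith)
        (by norm_num))).trans ?_
    exact rpow_le_of_pow_le 158 100 (by norm_num) (by norm_num) (by norm_num) (by norm_num)
      (by norm_num)
  have hbp' : ((r - 1) / 2) ^ (p - 1) ≤ 0.15 := by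
    refine ((Real.rpow_le_rpow_of_exponent_ge (y := p - 1) (z := 1.57) (by linarith) (by linarith)
      (by linarith)).trans
      (Real.rpow_le_rpow (by linarith) (show (r - 1) / 2 ≤ 0.2986 by linarith)
        (by norm_num))).trans ?_
    exact rpow_le_of_pow_le 157 100 (by norm_num) (by norm_num) (by norm_num) (by norm_num)
      (by norm_num)
  have hb0 : 0 < ((r - 1) / 2) ^ p := Real.rpow_pos_of_pos (by linarith) p
  have ha0' : 0 < ((r + 1) / 2) ^ (p - 1) := Real.rpow_pos_of_pos (by linarith) _
  have hb0' : 0 < ((r - 1) / 2) ^ (p - 1) := Real.rpow_pos_of_pos (by linarith) _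
  generalize ((r + 1) / 2) ^ p = a at *
  generalize ((r - 1) / 2) ^ p = b at *
  generalize ((r + 1) / 2) ^ (p - 1) = a' at *
  generalize ((r - 1) / 2) ^ (p - 1) = b' at *
  have t1 : 1.949 * (0.374 * Real.log 2) ≤ a * Real.log ((r + 1) / 2) :=
    mul_le_mul hap hloga (by positivity) (by linarith)
  have t2 : -(0.0448 * (1.754 * Real.log 2)) ≤ b * Real.log ((r - 1) / 2) := by
    nlinarith [mul_le_mul_of_nonneg_left hlogb hb0.le, mul_le_mul_of_nonneg_right hbp hL.le]
  have t3 : Real.log r - Real.log 2 * (q / (1 - q)) ≤ 0.4752 * Real.log 2 := by nlinarith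
  have t4 : r / 2 * (Real.log r - Real.log 2 * (q / (1 - q))) * (a' + b') ≤
      0.7986 * (0.4752 * Real.log 2) * 1.6612 := by
    have hs : 0 < r / 2 := by linarith
    calc r / 2 * (Real.log r - Real.log 2 * (q / (1 - q))) * (a' + b')
        ≤ r / 2 * (0.4752 * Real.log 2) * (a' + b') := by gcongr
      _ ≤ 0.7986 * (0.4752 * Real.log 2) * 1.6612 := by
          gcongr <;> linarith
  linarith

theorem critDefect_strictMonoOn : StrictMonoOn critDefect (Set.Icc 2.57 2.58) := by
  have hder : ∀ p ∈ Set.Icc (2.57 : ℝ) 2.58, HasDerivAt critDefect _ p := fun p hp =>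
    hasDerivAt_critDefect (by linarith [hp.1]) (by linarith [(critRatio_mem hp.1 hp.2).1])
  refine strictMonoOn_of_deriv_pos (convex_Icc _ _)
    (fun p hp => (hder p hp).continuousAt.continuousWithinAt) fun p hp => ?_
  have hp' := interior_subset hp
  rw [(hder p hp').deriv]
  exact critDefect_deriv_pos hp'.1 hp'.2

theorem critDefect_left_nonpos : critDefect 2.57 ≤ 0 := by
  have hq : (0.168404 : ℝ) ≤ 2 ^ (-2.57 : ℝ) := by
    rw [Real.rpow_neg (by norm_num), ← Real.inv_rpow (by norm_num)]
    exact le_rpow_of_pow_le 257 100 (by norm_num) (by norm_num) (by norm_num) (by norm_num)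
  obtain ⟨-, hq2⟩ := two_rpow_neg_mem (p := 2.57) (by norm_num) (by norm_num)
  have hr1 := (critRatio_mem (p := 2.57) (by norm_num) (by norm_num)).1
  have hr : critRatio 2.57 ≤ 1.596256 := by
    rw [critRatio, one_div, Real.rpow_inv_le_iff_of_pos (by linarith) (by norm_num) (by norm_num)]
    refine le_trans (by linarith) (le_rpow_of_pow_le (y := 3.326384) 257 100 (by norm_num)
      (by norm_num) (by norm_num) (by norm_num))
  have ha : ((critRatio 2.57 + 1) / 2) ^ (2.57 : ℝ) ≤ 1.95537 :=
    (Real.rpow_le_rpow (by linarith) (show _ ≤ 1.298128 by linarith) (by norm_num)).trans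
      (rpow_le_of_pow_le 257 100 (by norm_num) (by norm_num) (by norm_num) (by norm_num)
        (by norm_num))
  have hb : ((critRatio 2.57 - 1) / 2) ^ (2.57 : ℝ) ≤ 0.0446 :=
    (Real.rpow_le_rpow (by linarith) (show _ ≤ 0.298128 by linarith) (by norm_num)).trans
      (rpow_le_of_pow_le 257 100 (by norm_num) (by norm_num) (by norm_num) (by norm_num)
        (by norm_num))
  unfold critDefect
  linarith

theorem critDefect_right_nonneg : 0 ≤ critDefect 2.58 := by
  have hq : (2 : ℝ) ^ (-2.58 : ℝ) ≤ 0.167242 := by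
    rw [Real.rpow_neg (by norm_num), ← Real.inv_rpow (by norm_num)]
    exact rpow_le_of_pow_le 258 100 (by norm_num) (by norm_num) (by norm_num) (by norm_num)
      (by norm_num)
  have hr : 1.59422 ≤ critRatio 2.58 := by
    rw [critRatio, one_div, Real.le_rpow_inv_iff_of_pos (by norm_num) (by linarith) (by norm_num)]
    refine (rpow_le_of_pow_le (y := 3.33103) 258 100 (by norm_num) (by norm_num) (by norm_num)
      (by norm_num) (by norm_num)).trans (by linarith)
  have ha : 1.95649 ≤ ((critRatio 2.58 + 1) / 2) ^ (2.58 : ℝ) :=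
    (le_rpow_of_pow_le 258 100 (by norm_num) (by norm_num) (by norm_num) (by norm_num)).trans
      (Real.rpow_le_rpow (by norm_num) (show 1.29711 ≤ _ by linarith) (by norm_num))
  have hb : 0.04366 ≤ ((critRatio 2.58 - 1) / 2) ^ (2.58 : ℝ) :=
    (le_rpow_of_pow_le 258 100 (by norm_num) (by norm_num) (by norm_num) (by norm_num)).trans
      (Real.rpow_le_rpow (by norm_num) (show 0.29711 ≤ _ by linarith) (by norm_num))
  unfold critDefect
  linarith

/-- There exists a unique real number `p₀` with `2.57 ≤ p₀ ≤ 2.58`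
satisfying `Δ(p₀, σ_{p₀}) = Δ(p₀, 1)`. Here `TP p = τ_p` and `T p σ = τ(p,σ)` are the
implicitly defined functions. -/
theorem stmt_15 (TP : ℝ → ℝ)
    (hTP : ∀ p : ℝ, 1 < p →
      0 ≤ TP p ∧ TP p < 1 ∧ 2 * (1 - TP p) ^ p = 1 + TP p ^ p)
    (T : ℝ → ℝ → ℝ)
    (hT : ∀ p : ℝ, 1 < p → ∀ σ ∈ Set.Icc 1 (sigmaP p),
      0 ≤ T p σ ∧ T p σ ≤ TP p ∧
        Acoef p σ (T p σ) ^ p + Bcoef p σ (T p σ) ^ p = 1) :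
    ∃! p0 : ℝ, 2.57 ≤ p0 ∧ p0 ≤ 2.58 ∧
      DeltaFun p0 (T p0) (sigmaP p0) = DeltaFun p0 (T p0) 1 := by
  have key : ∀ p : ℝ, 2.57 ≤ p → p ≤ 2.58 →
      (DeltaFun p (T p) (sigmaP p) = DeltaFun p (T p) 1 ↔ critDefect p = 0) := by
    intro p h1 h2
    have hp : 1 < p := by linarith
    obtain ⟨t0, t1, ht⟩ := hTP p hp
    exact deltaFun_eq_iff hp (by linarith [(critRatio_mem h1 h2).1]) t0 t1 ht (hT p hp)
  have hcont : ContinuousOn critDefect (Set.Icc 2.57 2.58) := fun p hp =>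
    (hasDerivAt_critDefect (by linarith [hp.1])
      (by linarith [(critRatio_mem hp.1 hp.2).1])).continuousAt.continuousWithinAt
  obtain ⟨p, hp, hp0⟩ := intermediate_value_Icc (by norm_num) hcont
    ⟨critDefect_left_nonpos, critDefect_right_nonneg⟩
  refine ⟨p, ⟨hp.1, hp.2, (key p hp.1 hp.2).2 hp0⟩, ?_⟩
  rintro y ⟨hy1, hy2, hy⟩
  exact critDefect_strictMonoOn.injOn ⟨hy1, hy2⟩ hp (((key y hy1 hy2).1 hy).trans hp0.symm)
end

section
/- (Minkowski's sufficient bound) For every real p ≥ 1 and every full-rank lattice Λ ⊆ ℝ² with covolume d(Λ), there exists a nonzero point (x,y) ∈ Λ such that |x|^p + |y|^p ≤ κ_p^p · d(Λ)^{p/2}, where κ_p = Γ(1 + 2/p)^{1/2} / Γ(1 + 1/p) and Γ is the Gamma function. -/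
theorem convexOn_abs_rpow {p : ℝ} (hp : 1 ≤ p) : ConvexOn ℝ Set.univ fun t : ℝ ↦ |t| ^ p := by
  refine ConvexOn.comp (g := fun t : ℝ ↦ t ^ p) (f := fun t : ℝ ↦ |t|) ?_ ?_ ?_
  · refine (convexOn_rpow hp).subset ?_ ?_
    · rintro _ ⟨t, -, rfl⟩
      exact abs_nonneg t
    · have : (fun t : ℝ ↦ |t|) '' Set.univ = Set.Ici 0 := by
        ext t
        exact ⟨fun ⟨u, _, hu⟩ ↦ hu ▸ abs_nonneg u, fun ht ↦ ⟨t, trivial, abs_of_nonneg ht⟩⟩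
      exact this ▸ convex_Ici 0
  · exact convexOn_norm convex_univ
  · rintro _ ⟨t, -, rfl⟩ _ - htu
    exact Real.rpow_le_rpow (abs_nonneg t) htu (by linarith)

open MeasureTheory in
/-- Minkowski's convex body theorem for the `ℓ^p` ball of radius `r`. -/
theorem exists_ne_zero_mem_span_sum_rpow_le {ι : Type*} [Fintype ι] [Nonempty ι] [DecidableEq ι]
    {p : ℝ} (hp : 1 ≤ p) (B : Module.Basis ι ℝ (ι → ℝ)) {r : ℝ} (hr : 0 ≤ r)
    (hvol : |(Matrix.of B).det| * 2 ^ Fintype.card ι ≤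
      r ^ Fintype.card ι * ((2 * Real.Gamma (1 / p + 1)) ^ Fintype.card ι /
        Real.Gamma (Fintype.card ι / p + 1))) :
    ∃ x ∈ Submodule.span ℤ (Set.range B), x ≠ 0 ∧ ∑ i, |x i| ^ p ≤ r ^ p := by
  have hp0 : 0 < p := by linarith
  have hnonneg (x : ι → ℝ) : 0 ≤ ∑ i, |x i| ^ p := by positivity
  set s : Set (ι → ℝ) := {x | ∑ i, |x i| ^ p ≤ r ^ p} with hs
  have hs_eq : s = {x | (∑ i, |x i| ^ p) ^ (1 / p) ≤ r} := by
    ext x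
    simp only [hs, Set.mem_ofPred_eq]
    rw [one_div, Real.rpow_inv_le_iff_of_pos (hnonneg x) hr hp0]
  have hconv : Convex ℝ s := by
    have : ConvexOn ℝ Set.univ fun x : ι → ℝ ↦ ∑ i, |x i| ^ p := by
      refine ⟨convex_univ, fun x _ y _ α β hα hβ hαβ ↦ ?_⟩
      rw [Finset.smul_sum, Finset.smul_sum, ← Finset.sum_add_distrib]
      exact Finset.sum_le_sum fun i _ ↦ (convexOn_abs_rpow hp).2 trivial trivial hα hβ hαβ
    simpa using this.convex_le (r ^ p)
  have hclosed : IsClosed s := by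
    refine isClosed_le (continuous_finsetSum _ fun i _ ↦ ?_) continuous_const
    exact (continuous_apply i).abs.rpow_const fun _ ↦ Or.inr hp0.le
  have hcompact : IsCompact s := by
    refine Metric.isCompact_of_isClosed_isBounded hclosed
      ((Metric.isBounded_closedBall (x := 0) (r := r)).subset fun x hx ↦ ?_)
    rw [mem_closedBall_zero_iff, pi_norm_le_iff_of_nonneg hr]
    intro i
    rw [Real.norm_eq_abs, ← Real.rpow_le_rpow_iff (abs_nonneg _) hr hp0]
    exact (Finset.single_le_sum (f := fun i ↦ |x i| ^ p) (fun _ _ ↦ by positivity)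
      (Finset.mem_univ i)).trans hx
  have : Countable (Submodule.span ℤ (Set.range B)).toAddSubgroup :=
    inferInstanceAs (Countable (Submodule.span ℤ (Set.range B)))
  obtain ⟨x, hx0, hxs⟩ := exists_ne_zero_mem_lattice_of_measure_mul_two_pow_le_measure
    (ZSpan.isAddFundamentalDomain' B volume) (s := s) (fun x hx ↦ by simpa [hs] using hx)
    hconv hcompact (by
      rw [ZSpan.volume_fundamentalDomain, hs_eq, volume_sum_rpow_le ι hp, Module.finrank_pi,
        ← ENNReal.ofReal_pow hr, ← ENNReal.ofReal_mul (by positivity)]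
      refine le_trans (le_of_eq ?_) (ENNReal.ofReal_le_ofReal hvol)
      rw [ENNReal.ofReal_mul (abs_nonneg _), ENNReal.ofReal_pow zero_le_two, ENNReal.ofReal_ofNat])
  exact ⟨x, x.2, by simpa using hx0, hxs⟩

/-- Minkowski's radius `κ_p · √D` makes the volume of the planar `ℓ^p` ball equal to `4 D`. -/
theorem four_mul_eq_minkowskiRadius_sq_mul {p D : ℝ} (hp : 0 < p) (hD : 0 ≤ D) :
    D * 2 ^ 2 =
      (Real.Gamma (1 + 2 / p) ^ ((1 : ℝ) / 2) / Real.Gamma (1 + 1 / p) * D ^ ((1 : ℝ) / 2)) ^ 2 *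
        ((2 * Real.Gamma (1 / p + 1)) ^ 2 / Real.Gamma (2 / p + 1)) := by
  have h₁ : 0 < Real.Gamma (1 + 1 / p) := Real.Gamma_pos_of_pos (by positivity)
  have h₂ : 0 < Real.Gamma (1 + 2 / p) := Real.Gamma_pos_of_pos (by positivity)
  rw [add_comm (1 / p), add_comm (2 / p), ← Real.sqrt_eq_rpow, ← Real.sqrt_eq_rpow, mul_pow,
    div_pow, Real.sq_sqrt h₂.le, Real.sq_sqrt hD]
  field_simp


/-- The points of the full-rank lattice in `ℝ²` spanned by `(a, b)` and `(c, d)`. -/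
def latticePts (a b c d : ℝ) : Set (ℝ × ℝ) :=
  {v | ∃ m n : ℤ, v = (m * a + n * c, m * b + n * d)}

/-- A lattice is admissible for `M` if it contains no point of `M` other than possibly
the origin. -/
def IsAdmissible (a b c d : ℝ) (M : Set (ℝ × ℝ)) : Prop :=
  ∀ v ∈ latticePts a b c d, v ∈ M → v = 0

/-- The critical determinant of `M`: the infimum of the covolumes `|ad - bc|` over all
full-rank `M`-admissible lattices. -/
noncomputable def critDet (M : Set (ℝ × ℝ)) : ℝ :=
  sInf {δ : ℝ | ∃ a b c d : ℝ,
    a * d - b * c ≠ 0 ∧ IsAdmissible a b c d M ∧ δ = |a * d - b * c|}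

/-- The region `D_p = {(x,y) : |x|^p + |y|^p < 1}`. -/
def Dset (p : ℝ) : Set (ℝ × ℝ) := {v | |v.1| ^ p + |v.2| ^ p < 1}

/-- **Minkowski's sufficient bound.** For every real `p ≥ 1` and every
full-rank lattice `Λ ⊆ ℝ²` with covolume `d(Λ)`, there is a nonzero `(x,y) ∈ Λ` with
`|x|^p + |y|^p ≤ κ_p^p · d(Λ)^{p/2}`, where `κ_p = Γ(1 + 2/p)^{1/2} / Γ(1 + 1/p)`. -/
theorem stmt_18 (p : ℝ) (hp : 1 ≤ p) (a b c d : ℝ) (h : a * d - b * c ≠ 0) :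
    ∃ v ∈ latticePts a b c d, v ≠ 0 ∧
      |v.1| ^ p + |v.2| ^ p ≤
        (Real.Gamma (1 + 2 / p) ^ ((1 : ℝ) / 2) / Real.Gamma (1 + 1 / p)) ^ p *
          |a * d - b * c| ^ (p / 2) := by
  have hp0 : 0 < p := by linarith
  have hΓ : 0 < Real.Gamma (1 + 1 / p) := Real.Gamma_pos_of_pos (by positivity)
  have hΓ' : 0 < Real.Gamma (1 + 2 / p) := Real.Gamma_pos_of_pos (by positivity)
  have hdet : (!![a, b; c, d] : Matrix (Fin 2) (Fin 2) ℝ).det = a * d - b * c :=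
    Matrix.det_fin_two_of a b c d
  have hli : LinearIndependent ℝ (!![a, b; c, d] : Matrix (Fin 2) (Fin 2) ℝ).row :=
    Matrix.linearIndependent_rows_iff_isUnit.2
      ((Matrix.isUnit_iff_isUnit_det _).2 (hdet ▸ h.isUnit))
  let B := basisOfLinearIndependentOfCardEqFinrank hli (by simp)
  have hB : ⇑B = (!![a, b; c, d] : Matrix (Fin 2) (Fin 2) ℝ).row :=
    coe_basisOfLinearIndependentOfCardEqFinrank hli (by simp)
  have hBdet : (Matrix.of B).det = a * d - b * c := by rw [hB]; exact hdet
  obtain ⟨x, hx, hx0, hxle⟩ := exists_ne_zero_mem_span_sum_rpow_le hp B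
    (r := Real.Gamma (1 + 2 / p) ^ ((1 : ℝ) / 2) / Real.Gamma (1 + 1 / p) *
      |a * d - b * c| ^ ((1 : ℝ) / 2)) (by positivity) (by
        rw [hBdet, Fintype.card_fin, Nat.cast_ofNat]
        exact (four_mul_eq_minkowskiRadius_sq_mul hp0 (abs_nonneg _)).le)
  obtain ⟨m, rfl⟩ := (Submodule.mem_span_range_iff_exists_fun ℤ).1 hx
  set x := ∑ i, m i • B i with hxdef
  refine ⟨(x 0, x 1), ⟨m 0, m 1, ?_⟩, fun hv ↦ hx0 ?_, ?_⟩
  · simp [hxdef, hB, Fin.sum_univ_two]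
  · ext i
    fin_cases i
    · exact congrArg Prod.fst hv
    · exact congrArg Prod.snd hv
  · rw [Fin.sum_univ_two, Real.mul_rpow (by positivity) (by positivity),
      ← Real.rpow_mul (abs_nonneg _), one_div_mul_eq_div] at hxle
    exact hxle
end
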